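/- arXiv:2108.09036 — 6 statements merged into one kernel-verified Lean document; each statement's English description precedes it below -/
import Mathlib

section
/- Let u0 satisfy (1.2) and (1.10). Then u0′(x)/u0(x) → 0 as x → +∞. -/
/-- Conditions (1.2) and (1.10) on the initial function `u0`, with `u0'`, `u0''` its
first and second derivatives on `[ξ0, ∞)`. -/
def SlowlyDecayingInit (u0 u0' u0'' : ℝ → ℝ) (ξ0 : ℝ) : Prop :=
  Continuous u0 ∧ (∀ x, 0 < u0 x) ∧
    0 < Filter.liminf u0 Filter.atBot ∧
    Filter.Tendsto u0 Filter.atTop (nhds 0) ∧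
    (∀ x, ξ0 ≤ x → HasDerivAt u0 (u0' x) x) ∧
    (∀ x, ξ0 ≤ x → HasDerivAt u0' (u0'' x) x) ∧
    ContinuousOn u0'' (Set.Ici ξ0) ∧
    (∀ x, ξ0 ≤ x → u0' x ≤ 0) ∧
    Filter.Tendsto (fun x => u0'' x / u0 x) Filter.atTop (nhds 0)

/-- Lemma 2.3(i): if `u0` satisfies (1.2) and (1.10), then `u0'(x)/u0(x) → 0`
as `x → +∞`. -/
theorem stmt0 (u0 u0' u0'' : ℝ → ℝ) (ξ0 : ℝ)
    (h : SlowlyDecayingInit u0 u0' u0'' ξ0) :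
    Filter.Tendsto (fun x => u0' x / u0 x) Filter.atTop (nhds 0) := by
  obtain ⟨-, hpos, -, -, h1, h2, -, hneg, hlim⟩ := h
  rw [Metric.tendsto_atTop] at hlim ⊢
  intro ε hε
  obtain ⟨N, hN⟩ := hlim (ε ^ 2 / 4) (by positivity)
  refine ⟨max N ξ0, fun x hx => ?_⟩
  have hxN : N ≤ x := le_trans (le_max_left _ _) hx
  have hxξ : ξ0 ≤ x := le_trans (le_max_right _ _) hx
  have anti : ∀ y, x ≤ y → u0 y ≤ u0 x := by
    intro y hy
    rcases hy.eq_or_lt with rfl | hlt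
    · exact le_rfl
    obtain ⟨c, hc, hceq⟩ := exists_hasDerivAt_eq_slope u0 u0' hlt
      (fun z hz => (h1 z (hxξ.trans hz.1)).continuousAt.continuousWithinAt)
      (fun z hz => h1 z (hxξ.trans hz.1.le))
    have hc0 := hneg c (hxξ.trans hc.1.le)
    have hd : 0 < y - x := sub_pos.2 hlt
    rw [eq_div_iff hd.ne'] at hceq
    nlinarith
  have hh : 0 < 2 / ε := by positivity
  have hlt : x < x + 2 / ε := by linarith
  obtain ⟨c, hc, hceq⟩ := exists_hasDerivAt_eq_slope u0 u0' hlt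
    (fun z hz => (h1 z (hxξ.trans hz.1)).continuousAt.continuousWithinAt)
    (fun z hz => h1 z (hxξ.trans hz.1.le))
  obtain ⟨d, hd, hdeq⟩ := exists_hasDerivAt_eq_slope u0' u0'' hc.1
    (fun z hz => (h2 z (hxξ.trans hz.1)).continuousAt.continuousWithinAt)
    (fun z hz => h2 z (hxξ.trans hz.1.le))
  have hcx : 0 < c - x := sub_pos.2 hc.1
  rw [eq_div_iff hcx.ne'] at hdeq
  rw [add_sub_cancel_left, eq_div_iff hh.ne'] at hceq
  have hdd := hN d (hxN.trans hd.1.le)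
  rw [Real.dist_eq, sub_zero] at hdd
  have hdd2 := (abs_lt.1 hdd).2
  rw [div_lt_iff₀ (hpos d)] at hdd2
  have hud := anti d hd.1.le
  have hA : u0'' d ≤ ε ^ 2 / 4 * u0 x := hdd2.le.trans (by gcongr)
  have hux := hpos x
  have hB : u0' c - u0' x ≤ ε / 2 * u0 x := by
    rw [← hdeq]
    calc u0'' d * (c - x) ≤ ε ^ 2 / 4 * u0 x * (c - x) := by gcongr
      _ ≤ ε ^ 2 / 4 * u0 x * (2 / ε) := by
        gcongr
        linarith [hc.2]
      _ = ε / 2 * u0 x := by field_simp; ring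
  have hC : u0' c = (u0 (x + 2 / ε) - u0 x) * (ε / 2) := by
    rw [← hceq]; field_simp
  have hp := mul_pos (hpos (x + 2 / ε)) hε
  rw [Real.dist_eq, sub_zero, abs_lt]
  constructor
  · rw [lt_div_iff₀ hux]
    nlinarith
  · exact lt_of_le_of_lt (div_nonpos_of_nonpos_of_nonneg (hneg x hxξ) hux.le) hε
end

section
/- Let u0 satisfy (1.2) and (1.10). Then u0 decays more slowly than any exponentially decaying function as x → +∞: for every κ > 0 there exists x_κ ∈ ℝ such that u0(x) ≥ e^{−κ x} for all x ∈ [x_κ, +∞). -/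
/-- Lemma 2.3(ii): if `u0` satisfies (1.2) and (1.10), then `u0` decays more slowly
than any exponentially decaying function: for every `κ > 0` there is `xκ` with
`u0 x ≥ exp (-κ x)` for all `x ≥ xκ`. -/
theorem stmt1 (u0 u0' u0'' : ℝ → ℝ) (ξ0 : ℝ)
    (h : SlowlyDecayingInit u0 u0' u0'' ξ0) :
    ∀ κ : ℝ, 0 < κ → ∃ xκ : ℝ, ∀ x, xκ ≤ x → Real.exp (-κ * x) ≤ u0 x := by
  obtain ⟨-, hpos, -, -, hd1, hd2, -, hneg, hlim⟩ := h
  intro κ hκ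
  obtain ⟨a, ha, rfl⟩ : ∃ a : ℝ, 0 < a ∧ κ = 2 * a := ⟨κ / 2, by positivity, by ring⟩
  have hev : ∀ᶠ x in Filter.atTop, u0'' x / u0 x < a ^ 2 :=
    hlim.eventually_lt_const (by positivity)
  obtain ⟨X0, hX0⟩ := Filter.eventually_atTop.1 hev
  obtain ⟨X, hXξ, hXX⟩ : ∃ X, ξ0 ≤ X ∧ X0 ≤ X := ⟨max ξ0 X0, le_max_left _ _, le_max_right _ _⟩
  have hdd : ∀ x, X ≤ x → u0'' x ≤ a ^ 2 * u0 x := fun x hx =>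
    ((div_lt_iff₀ (hpos x)).1 (hX0 x (hXX.trans hx))).le
  have mono : ∀ f f' : ℝ → ℝ, (∀ x, X ≤ x → HasDerivAt f (f' x) x) →
      (∀ x, X ≤ x → 0 ≤ f' x) → ∀ y z, X ≤ y → y ≤ z → f y ≤ f z := by
    intro f f' hf hf' y z hy hyz
    have hm : MonotoneOn f (Set.Ici X) := by
      apply monotoneOn_of_deriv_nonneg (convex_Ici X)
      · intro x hx
        exact (hf x hx).continuousAt.continuousWithinAt
      · intro x hx
        exact (hf x (interior_subset hx)).differentiableAt.differentiableWithinAt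
      · intro x hx
        rw [(hf x (interior_subset hx)).deriv]
        exact hf' x (interior_subset hx)
    exact hm hy (hy.trans hyz : X ≤ z) hyz
  have hE : ∀ y z, X ≤ y → y ≤ z →
      u0' y ^ 2 - a ^ 2 * u0 y ^ 2 ≤ u0' z ^ 2 - a ^ 2 * u0 z ^ 2 := by
    apply mono (fun x => u0' x ^ 2 - a ^ 2 * u0 x ^ 2)
      (fun x => 2 * u0' x * (u0'' x - a ^ 2 * u0 x))
    · intro x hx
      have h1 := hd1 x (hXξ.trans hx)
      have h2 := hd2 x (hXξ.trans hx)
      refine ((h2.pow 2).sub ((h1.pow 2).const_mul (a ^ 2))).congr_deriv ?_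
      norm_num
      ring
    · intro x hx
      have h1 := hneg x (hXξ.trans hx)
      have h2 := hdd x hx
      exact mul_nonneg_of_nonpos_of_nonpos (by linarith) (by linarith)
  have hE0 : ∀ y, X ≤ y → u0' y ^ 2 - a ^ 2 * u0 y ^ 2 ≤ 0 := by
    intro y hy
    by_contra! hc
    obtain ⟨s, hs, hsc⟩ : ∃ s : ℝ, 0 < s ∧ s ^ 2 = u0' y ^ 2 - a ^ 2 * u0 y ^ 2 :=
      ⟨_, Real.sqrt_pos.2 hc, Real.sq_sqrt hc.le⟩
    have hle : ∀ z, y ≤ z → u0' z ≤ -s := by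
      intro z hz
      have h1 := hE y z hy hz
      have h2 := hneg z (hXξ.trans (hy.trans hz))
      have h3 : 0 ≤ a ^ 2 * u0 z ^ 2 := by positivity
      have h4 : s ≤ -u0' z := by
        apply le_of_sq_le_sq _ (by linarith)
        nlinarith
      linarith
    have hz : y ≤ y + u0 y / s := by
      have := div_pos (hpos y) hs
      linarith
    have hm : MonotoneOn (fun x => -u0 x - s * x) (Set.Ici y) := by
      have hf : ∀ x, y ≤ x → HasDerivAt (fun x => -u0 x - s * x) (-u0' x - s * 1) x :=
        fun x hx => (hd1 x (hXξ.trans (hy.trans hx))).neg.sub ((hasDerivAt_id x).const_mul s)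
      apply monotoneOn_of_deriv_nonneg (convex_Ici y)
      · intro x hx
        exact (hf x hx).continuousAt.continuousWithinAt
      · intro x hx
        exact (hf x (interior_subset hx)).differentiableAt.differentiableWithinAt
      · intro x hx
        rw [(hf x (interior_subset hx)).deriv]
        have := hle x (interior_subset hx)
        linarith
    have h5 := hm (le_refl y : y ∈ Set.Ici y) hz hz
    have h6 : s * (u0 y / s) = u0 y := by field_simp
    have h7 := hpos (y + u0 y / s)
    simp only [mul_add] at h5
    linarith
  have hlow : ∀ y, X ≤ y → 0 ≤ u0' y + a * u0 y := by
    intro y hy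
    have h1 := hE0 y hy
    have h2 := mul_pos ha (hpos y)
    have h3 := abs_le_of_sq_le_sq' (a := u0' y) (b := a * u0 y) (by nlinarith) h2.le
    linarith [h3.1]
  have hG := mono (fun x => u0 x * Real.exp (a * x))
      (fun x => (u0' x + a * u0 x) * Real.exp (a * x)) (by
        intro x hx
        have h1 := hd1 x (hXξ.trans hx)
        have h2 := ((hasDerivAt_id x).const_mul a).exp
        refine (h1.mul h2).congr_deriv ?_
        simp only [id]
        ring) (fun x hx => mul_nonneg (hlow x hx) (Real.exp_pos _).le) X
  set C := u0 X * Real.exp (a * X) with hC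
  have hCpos : 0 < C := mul_pos (hpos X) (Real.exp_pos _)
  refine ⟨max X (-Real.log C / a), fun x hx => ?_⟩
  have h1 := hG x le_rfl ((le_max_left _ _).trans hx)
  have h2 : -Real.log C / a ≤ x := (le_max_right _ _).trans hx
  rw [div_le_iff₀ ha] at h2
  have h3 : Real.exp (-(a * x)) ≤ C := by
    rw [← Real.le_log_iff_exp_le hCpos]
    linarith
  have h4 : Real.exp (-(2 * a) * x) * Real.exp (a * x) = Real.exp (-(a * x)) := by
    rw [← Real.exp_add]
    ring_nf
  have h5 : Real.exp (-(2 * a) * x) * Real.exp (a * x) ≤ u0 x * Real.exp (a * x) := by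
    rw [h4]
    exact h3.trans h1
  exact le_of_mul_le_mul_right h5 (Real.exp_pos _)
end

section
/- Let u0 satisfy (1.2) and (1.10). Let γ1 > 0, γ2 > 0, and ρ1 > ρ2 > 0, and suppose y1, y2 : (0,∞) → ℝ satisfy u0(y1(t)) = γ1 e^{−ρ1 t} and u0(y2(t)) = γ2 e^{−ρ2 t} for all sufficiently large t. Then y1(t) − y2(t) → +∞ as t → +∞. -/
theorem aux_y (u0 : ℝ → ℝ) (hc : Continuous u0) (hpos : ∀ x, 0 < u0 x)
    (hl : 0 < Filter.liminf u0 Filter.atBot) (γ ρ : ℝ) (hρ : 0 < ρ) (y : ℝ → ℝ)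
    (T : ℝ) (hy : ∀ t, T ≤ t → u0 (y t) = γ * Real.exp (-ρ * t)) :
    Filter.Tendsto y Filter.atTop Filter.atTop := by
  rw [Filter.liminf_eq] at hl
  have hne : {a : ℝ | ∀ᶠ n in Filter.atBot, a ≤ u0 n}.Nonempty :=
    ⟨0, Filter.Eventually.of_forall fun x => (hpos x).le⟩
  obtain ⟨a, ha, ha0⟩ := exists_lt_of_lt_csSup hne hl
  obtain ⟨B, hB⟩ := Filter.eventually_atBot.1 ha
  rw [Filter.tendsto_atTop]
  intro R
  obtain ⟨m, hm, hmR⟩ : ∃ m > 0, ∀ x ≤ R, m ≤ u0 x := by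
    obtain ⟨z, hz, hzm⟩ := (isCompact_Icc (a := min B R) (b := R)).exists_isMinOn
      ⟨R, by simp⟩ hc.continuousOn
    refine ⟨min a (u0 z), lt_min ha0 (hpos z), fun x hx => ?_⟩
    rcases le_total x (min B R) with h1 | h1
    · exact (min_le_left _ _).trans (hB x (h1.trans (min_le_left _ _)))
    · exact (min_le_right _ _).trans (hzm ⟨h1, hx⟩)
  have ht : Filter.Tendsto (fun t => γ * Real.exp (-ρ * t)) Filter.atTop (nhds 0) := by
    have h1 : Filter.Tendsto (fun t : ℝ => -ρ * t) Filter.atTop Filter.atBot :=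
      Filter.tendsto_id.const_mul_atTop_of_neg (by linarith)
    simpa using (Real.tendsto_exp_atBot.comp h1).const_mul γ
  filter_upwards [ht.eventually_lt_const hm, Filter.eventually_ge_atTop T] with t h1 h2
  by_contra h3
  have := hmR (y t) (not_le.1 h3).le
  rw [hy t h2] at this
  linarith

/-- Lemma 2.3(iii): if `u0` satisfies (1.2) and (1.10), `γ1, γ2 > 0`, `ρ1 > ρ2 > 0`,
and `u0 (y1 t) = γ1 exp (-ρ1 t)`, `u0 (y2 t) = γ2 exp (-ρ2 t)` for all large `t`, then
`y1 t - y2 t → +∞` as `t → +∞`. -/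
theorem stmt2 (u0 u0' u0'' : ℝ → ℝ) (ξ0 γ1 γ2 ρ1 ρ2 : ℝ)
    (h : SlowlyDecayingInit u0 u0' u0'' ξ0)
    (hγ1 : 0 < γ1) (hγ2 : 0 < γ2) (hρ2 : 0 < ρ2) (hρ : ρ2 < ρ1)
    (y1 y2 : ℝ → ℝ)
    (hy : ∃ T : ℝ, ∀ t, T ≤ t →
      u0 (y1 t) = γ1 * Real.exp (-ρ1 * t) ∧ u0 (y2 t) = γ2 * Real.exp (-ρ2 * t)) :
    Filter.Tendsto (fun t => y1 t - y2 t) Filter.atTop Filter.atTop := by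
  obtain ⟨hc, hpos, hl, -, hd, hd2, -, hneg, hlim⟩ := h
  obtain ⟨T, hT⟩ := hy
  have hy1 := aux_y u0 hc hpos hl γ1 ρ1 (hρ2.trans hρ) y1 T fun t ht => (hT t ht).1
  have hy2 := aux_y u0 hc hpos hl γ2 ρ2 hρ2 y2 T fun t ht => (hT t ht).2
  obtain ⟨X0, hX0⟩ := Filter.eventually_atTop.1 (hlim.eventually_lt_const one_pos)
  set X := max X0 ξ0 with hX
  have hXξ : ξ0 ≤ X := le_max_right _ _
  have hu2 : ∀ x, X ≤ x → u0'' x ≤ u0 x := fun x hx => by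
    have := hX0 x ((le_max_left _ _).trans hx)
    rw [div_lt_one (hpos x)] at this
    exact this.le
  have hanti : AntitoneOn u0 (Set.Ici X) := by
    refine antitoneOn_of_hasDerivWithinAt_nonpos (f' := u0') (convex_Ici X) hc.continuousOn ?_ ?_
    · intro x hx
      rw [interior_Ici] at hx
      exact (hd x (hXξ.trans (le_of_lt hx))).hasDerivWithinAt
    · intro x hx
      rw [interior_Ici] at hx
      exact hneg x (hXξ.trans (le_of_lt hx))
  have hu1 : ∀ x, X ≤ x → -2 * u0 x ≤ u0' x := by
    intro x hx
    obtain ⟨c, hc1, hc2⟩ := exists_hasDerivAt_eq_slope u0 u0' (show x < x + 1 by linarith)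
      hc.continuousOn (fun z hz => hd z (by linarith [hz.1]))
    obtain ⟨d, hd1, hd3⟩ := exists_hasDerivAt_eq_slope u0' u0'' hc1.1
      (fun z hz => (hd2 z (by linarith [hz.1])).continuousAt.continuousWithinAt)
      (fun z hz => hd2 z (by linarith [hz.1]))
    have h1 : u0' c = u0 (x + 1) - u0 x := by rw [hc2]; simp
    have h2 : u0' c - u0' x = u0'' d * (c - x) := by
      rw [hd3, div_mul_cancel₀]; linarith [hc1.1]
    have hxd : X ≤ d := by linarith [hd1.1]
    have h3 := hu2 d hxd
    have h4 : u0 d ≤ u0 x := hanti hx hxd hd1.1.le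
    have h5 : u0'' d * (c - x) ≤ u0 x * 1 := by
      have := hc1.1
      have := hc1.2
      have := hpos x
      calc u0'' d * (c - x) ≤ u0 x * (c - x) := by gcongr <;> linarith
        _ ≤ u0 x * 1 := by gcongr; linarith
    have := hpos (x + 1)
    linarith
  have hmono : MonotoneOn (fun x => Real.log (u0 x) + 2 * x) (Set.Ici X) := by
    refine monotoneOn_of_hasDerivWithinAt_nonneg (f' := fun x => u0' x / u0 x + 2 * 1)
      (convex_Ici X) ?_ ?_ ?_
    · exact ((hc.log fun x => (hpos x).ne').add (by fun_prop)).continuousOn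
    · intro x hx
      rw [interior_Ici] at hx
      exact (((hd x (hXξ.trans (le_of_lt hx))).log (hpos x).ne').add
        ((hasDerivAt_id x).const_mul 2)).hasDerivWithinAt
    · intro x hx
      rw [interior_Ici] at hx
      have h1 := hu1 x (le_of_lt hx)
      have : -2 ≤ u0' x / u0 x := by rwa [le_div_iff₀ (hpos x)]
      linarith
  have hD : Filter.Tendsto (fun t => (Real.log γ2 - Real.log γ1) + (ρ1 - ρ2) * t)
      Filter.atTop Filter.atTop :=
    Filter.tendsto_atTop_add_const_left _ _
      (Filter.tendsto_id.const_mul_atTop (by linarith))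
  refine Filter.tendsto_atTop_mono' _ ?_ (hD.const_mul_atTop (show (0:ℝ) < 1 / 2 by norm_num))
  filter_upwards [hy1.eventually_ge_atTop X, hy2.eventually_ge_atTop X,
    Filter.eventually_ge_atTop T, hD.eventually_gt_atTop 0] with t h1 h2 h3 h4
  have e1 : Real.log (u0 (y1 t)) = Real.log γ1 + -ρ1 * t := by
    rw [(hT t h3).1, Real.log_mul hγ1.ne' (Real.exp_ne_zero _), Real.log_exp]
  have e2 : Real.log (u0 (y2 t)) = Real.log γ2 + -ρ2 * t := by
    rw [(hT t h3).2, Real.log_mul hγ2.ne' (Real.exp_ne_zero _), Real.log_exp]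
  rcases le_total (y1 t) (y2 t) with h5 | h5
  · have := Real.log_le_log (hpos _) (hanti h1 h2 h5)
    rw [e1, e2] at this
    exfalso
    linarith
  · have := hmono h2 h1 h5
    simp only [e1, e2] at this
    linarith
end

section
/- Let ξ0 ∈ ℝ and let g : [ξ0, ∞) → ℝ be continuously differentiable with g(x) ≤ 0 for all x ∈ [ξ0,∞), and suppose g′(x) + g(x)² → 0 as x → +∞. Then g(x) has a limit as x → +∞ in [−∞, 0] (i.e. either g converges to a finite nonpositive limit or g(x) → −∞); moreover this limit is 0, so g(x) → 0 as x → +∞. -/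
/-- Key intermediate claim in the proof of Lemma 2.3(i): if `g` is `C¹` on `[ξ0, ∞)`
with `g ≤ 0` there and `g' + g² → 0` as `x → +∞`, then `g` has a limit at `+∞` in
`[-∞, 0]`, and this limit is `0`; i.e. `g(x) → 0` as `x → +∞`. -/
theorem stmt3 (ξ0 : ℝ) (g g' : ℝ → ℝ)
    (hderiv : ∀ x, ξ0 ≤ x → HasDerivAt g (g' x) x)
    (hcont : ContinuousOn g' (Set.Ici ξ0))
    (hnonpos : ∀ x, ξ0 ≤ x → g x ≤ 0)
    (hlim : Filter.Tendsto (fun x => g' x + (g x) ^ 2) Filter.atTop (nhds 0)) :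
    Filter.Tendsto g Filter.atTop (nhds 0) := by
  rw [Metric.tendsto_atTop]
  intro ε hε
  obtain ⟨N, hN⟩ := (Metric.tendsto_atTop.1 hlim) (ε ^ 2 / 2) (by positivity)
  refine ⟨max N ξ0, fun x0 hx0 => ?_⟩
  have hx0N : N ≤ x0 := le_trans (le_max_left _ _) hx0
  have hx0ξ : ξ0 ≤ x0 := le_trans (le_max_right _ _) hx0
  by_contra hcon
  have hb : ∀ x, x0 ≤ x → g' x + (g x) ^ 2 < ε ^ 2 / 2 := by
    intro x hx
    have h := hN x (hx0N.trans hx)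
    rw [Real.dist_eq, sub_zero] at h
    exact (abs_lt.1 h).2
  have hg0 : g x0 ≤ -ε := by
    rw [Real.dist_eq, sub_zero, abs_of_nonpos (hnonpos x0 hx0ξ)] at hcon
    linarith
  have hbar : ∀ x, x0 ≤ x → g x ≤ -ε := by
    intro x hx
    have := image_le_of_deriv_right_lt_deriv_boundary (f := g) (f' := g') (a := x0) (b := x)
      (B := fun _ => -ε) (B' := fun _ => 0)
      (fun y hy => (hderiv y (hx0ξ.trans hy.1)).continuousAt.continuousWithinAt)
      (fun y hy => (hderiv y (hx0ξ.trans hy.1)).hasDerivWithinAt)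
      hg0 (fun y => hasDerivAt_const y _)
      (fun y hy hy2 => by
        have h1 := hb y hy.1
        have h2 : g y = -ε := hy2
        rw [h2] at h1
        have : 0 < ε ^ 2 := by positivity
        show g' y < 0
        nlinarith)
    exact this ⟨hx, le_rfl⟩
  have hd : ∀ x, x0 ≤ x → HasDerivAt (fun y => (g y)⁻¹) (-g' x / g x ^ 2) x := by
    intro x hx
    have := hbar x hx
    exact (hderiv x (hx0ξ.trans hx)).fun_inv (by linarith)
  have hpos : 0 < 2 / ε := by positivity
  obtain ⟨c, hc, hs⟩ := exists_hasDerivAt_eq_slope (fun y => (g y)⁻¹)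
    (fun x => -g' x / g x ^ 2) (a := x0) (b := x0 + 2 / ε) (by linarith)
    (fun y hy => (hd y hy.1).continuousAt.continuousWithinAt)
    (fun y hy => hd y hy.1.le)
  have hgc := hbar c hc.1.le
  have hbc := hb c hc.1.le
  have hg2 : ε ^ 2 ≤ g c ^ 2 := by nlinarith
  have h1 : 1 / 2 ≤ -g' c / g c ^ 2 := by
    rw [le_div_iff₀ (lt_of_lt_of_le (by positivity) hg2)]
    linarith
  have h2 : (g (x0 + 2 / ε))⁻¹ < 0 := by
    have := hbar (x0 + 2 / ε) (by linarith)
    exact inv_lt_zero.2 (by linarith)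
  have h3 : -(1 / ε) ≤ (g x0)⁻¹ := by
    have : (-g x0)⁻¹ ≤ ε⁻¹ := inv_anti₀ hε (by linarith)
    rw [inv_neg] at this
    rw [one_div]
    linarith
  rw [hs, add_sub_cancel_left, le_div_iff₀ hpos] at h1
  have h4 : 1 / 2 * (2 / ε) = 1 / ε := by ring
  linarith
end

section
/- Let χ, a, b, λ, μ be positive constants with b > 2χμ. Suppose φ, ψ : ℝ → ℝ are bounded, uniformly continuous, twice continuously differentiable functions with inf_{x∈ℝ} φ(x) > 0, satisfying the stationary system φ″ − χ(φψ′)′ + φ(a − bφ) = 0 and ψ″ − λψ + μφ = 0 on ℝ. Then φ ≡ a/b and ψ ≡ aμ/(bλ). -/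
theorem aux_limit (A L : ℝ) (h : ∀ ε > 0, A ≤ ε * L) : A ≤ 0 := by
  by_contra hA
  push Not at hA
  have h1 : 0 < |L| + 1 := by positivity
  have h2 := h (A / (2 * (|L| + 1))) (by positivity)
  have h3 : A / (2 * (|L| + 1)) * L ≤ A / (2 * (|L| + 1)) * (|L| + 1) := by
    apply mul_le_mul_of_nonneg_left _ (by positivity)
    linarith [le_abs_self L]
  have h4 : A / (2 * (|L| + 1)) * (|L| + 1) = A / 2 := by field_simp
  linarith

theorem aux_second (g g' g'' : ℝ → ℝ) (hd : ∀ x, HasDerivAt g (g' x) x)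
    (hd2 : ∀ x, HasDerivAt g' (g'' x) x) (x : ℝ) (hx : ∀ y, g y ≤ g x) :
    g' x = 0 ∧ g'' x ≤ 0 := by
  have hdg : deriv g = g' := funext fun z => (hd z).deriv
  have h0 : g' x = 0 := by
    have : IsLocalMax g x := Filter.Eventually.of_forall hx
    exact this.hasDerivAt_eq_zero (hd x)
  refine ⟨h0, ?_⟩
  by_contra hpos
  push Not at hpos
  have hmin : IsLocalMin g x := by
    apply isLocalMin_of_deriv_deriv_pos
    · rw [hdg, (hd2 x).deriv]; exact hpos
    · rw [hdg, h0]
    · exact (hd x).continuousAt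
  have heq : g =ᶠ[nhds x] fun _ => g x := by
    filter_upwards [hmin] with y hy
    exact le_antisymm (hx y) hy
  have h1 := heq.deriv
  rw [hdg] at h1
  have h2 := h1.deriv_eq
  rw [(hd2 x).deriv] at h2
  simp at h2
  linarith

theorem aux_maxp (f f' f'' : ℝ → ℝ) (hd : ∀ x, HasDerivAt f (f' x) x)
    (hd2 : ∀ x, HasDerivAt f' (f'' x) x) (C : ℝ) (hC : ∀ x, |f x| ≤ C)
    (y ε : ℝ) (hε : 0 < ε) :
    ∃ x, f y - ε ≤ f x ∧ |f' x| ≤ ε ∧ f'' x ≤ ε := by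
  have hC0 : 0 ≤ C := (abs_nonneg _).trans (hC 0)
  obtain ⟨δ, hδ, h1, h2, h3⟩ : ∃ δ > 0, δ * y ^ 2 ≤ ε ∧ 2 * δ ≤ ε ∧ 8 * C * δ ≤ ε ^ 2 := by
    refine ⟨min (ε / (y ^ 2 + 2)) (ε ^ 2 / (8 * C + 1)), by positivity, ?_, ?_, ?_⟩
    · calc _ ≤ ε / (y ^ 2 + 2) * y ^ 2 := by gcongr; exact min_le_left _ _
        _ ≤ ε / (y ^ 2 + 2) * (y ^ 2 + 2) := by gcongr; linarith
        _ = ε := by field_simp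
    · calc _ ≤ 2 * (ε / (y ^ 2 + 2)) := by gcongr; exact min_le_left _ _
        _ ≤ (y ^ 2 + 2) * (ε / (y ^ 2 + 2)) := by gcongr; nlinarith [sq_nonneg y]
        _ = ε := by field_simp
    · calc _ ≤ 8 * C * (ε ^ 2 / (8 * C + 1)) := by gcongr; exact min_le_right _ _
        _ ≤ (8 * C + 1) * (ε ^ 2 / (8 * C + 1)) := by gcongr; linarith
        _ = ε ^ 2 := by field_simp
  have hgd : ∀ x, HasDerivAt (fun x => f x - δ * x ^ 2) (f' x - 2 * δ * x) x := fun x => by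
    have := (hd x).sub ((hasDerivAt_pow 2 x).const_mul δ)
    exact HasDerivAt.congr_deriv this (by norm_num; ring)
  have hgd2 : ∀ x, HasDerivAt (fun x => f' x - 2 * δ * x) (f'' x - 2 * δ) x := fun x => by
    have := (hd2 x).sub ((hasDerivAt_id x).const_mul (2 * δ))
    exact HasDerivAt.congr_deriv this (by ring)
  obtain ⟨x, hx⟩ : ∃ x, ∀ z, f z - δ * z ^ 2 ≤ f x - δ * x ^ 2 := by
    have hcont : Continuous (fun x => f x - δ * x ^ 2) :=
      continuous_iff_continuousAt.2 fun x => (hgd x).continuousAt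
    set R := 2 * C / δ + 1 with hR
    have hR1 : 1 ≤ R := by rw [hR]; have : 0 ≤ 2 * C / δ := by positivity
                           linarith
    have hRδ : δ * R = 2 * C + δ := by rw [hR]; field_simp
    obtain ⟨x, -, hx⟩ := (isCompact_Icc (a := -R) (b := R)).exists_isMaxOn
      ⟨0, by constructor <;> linarith⟩ hcont.continuousOn
    refine ⟨x, fun z => ?_⟩
    by_cases hz : z ∈ Set.Icc (-R) R
    · exact hx hz
    · have h0 : f 0 - δ * 0 ^ 2 ≤ f x - δ * x ^ 2 := hx (show (0:ℝ) ∈ Set.Icc (-R) R by constructor <;> linarith)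
      have hzR : R < |z| := by
        by_contra hc
        push Not at hc
        exact hz (abs_le.1 hc)
      have : R ≤ z ^ 2 := by rw [← sq_abs]; nlinarith
      have := mul_le_mul_of_nonneg_left this hδ.le
      have := abs_le.1 (hC z)
      have := abs_le.1 (hC 0)
      linarith
  obtain ⟨e1, e2⟩ := aux_second _ _ _ hgd hgd2 x hx
  refine ⟨x, ?_, ?_, by linarith⟩
  · have := hx y
    nlinarith [mul_nonneg hδ.le (sq_nonneg x)]
  · apply abs_le_of_sq_le_sq _ hε.le
    have h0 := hx 0
    have := abs_le.1 (hC x)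
    have := abs_le.1 (hC 0)
    have h4 : δ * x ^ 2 ≤ 2 * C := by linarith
    have h5 := mul_le_mul_of_nonneg_left h4 hδ.le
    have h6 : f' x = 2 * δ * x := by linarith
    rw [h6]
    nlinarith

theorem aux_dbound (f f' f'' : ℝ → ℝ) (hd : ∀ x, HasDerivAt f (f' x) x)
    (hd2 : ∀ x, HasDerivAt f' (f'' x) x) (C D : ℝ) (hC : ∀ x, |f x| ≤ C)
    (hD : ∀ x, |f'' x| ≤ D) (x : ℝ) : |f' x| ≤ 2 * C + D := by
  obtain ⟨c, hc, h1⟩ := exists_hasDerivAt_eq_slope f f' (show x < x + 1 by linarith)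
    (fun z _ => (hd z).continuousAt.continuousWithinAt) (fun z _ => hd z)
  obtain ⟨e, he, h2⟩ := exists_hasDerivAt_eq_slope f' f'' hc.1
    (fun z _ => (hd2 z).continuousAt.continuousWithinAt) (fun z _ => hd2 z)
  have hc0 : 0 < c - x := by linarith [hc.1]
  rw [eq_div_iff hc0.ne'] at h2
  have h3 : f' c = f (x + 1) - f x := by rw [h1]; simp
  have h4 : |f'' e * (c - x)| ≤ D := by
    rw [abs_mul, abs_of_pos hc0]
    nlinarith [hc.2, hD e, abs_nonneg (f'' e)]
  have := abs_le.1 h4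
  have := abs_le.1 (hC x)
  have := abs_le.1 (hC (x + 1))
  rw [abs_le]; constructor <;> linarith


/-- Lemma 2.2: if `b > 2χμ`, the only bounded, uniformly continuous, twice
continuously differentiable solution `(φ, ψ)` of the stationary system
`φ'' - χ (φ ψ')' + φ (a - b φ) = 0`, `ψ'' - λ ψ + μ φ = 0` with
`inf φ > 0` is the constant state `(a/b, aμ/(bλ))`. -/
theorem stmt5 (χ a b lam mu : ℝ)
    (hχ : 0 < χ) (ha : 0 < a) (hb : 0 < b) (hlam : 0 < lam) (hmu : 0 < mu)
    (hb2 : 2 * χ * mu < b)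
    (φ φ' φ'' ψ ψ' ψ'' : ℝ → ℝ)
    (hφd : ∀ x, HasDerivAt φ (φ' x) x)
    (hφd2 : ∀ x, HasDerivAt φ' (φ'' x) x)
    (hψd : ∀ x, HasDerivAt ψ (ψ' x) x)
    (hψd2 : ∀ x, HasDerivAt ψ' (ψ'' x) x)
    (hφc : Continuous φ'') (hψc : Continuous ψ'')
    (hφb : ∃ M : ℝ, ∀ x, |φ x| ≤ M) (hψb : ∃ M : ℝ, ∀ x, |ψ x| ≤ M)
    (hφu : UniformContinuous φ) (hψu : UniformContinuous ψ)
    (hinf : ∃ m : ℝ, 0 < m ∧ ∀ x, m ≤ φ x)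
    (heq1 : ∀ x, φ'' x - χ * (φ' x * ψ' x + φ x * ψ'' x) + φ x * (a - b * φ x) = 0)
    (heq2 : ∀ x, ψ'' x - lam * ψ x + mu * φ x = 0) :
    (∀ x, φ x = a / b) ∧ (∀ x, ψ x = a * mu / (b * lam)) := by

  obtain ⟨C, hC⟩ := hφb
  obtain ⟨P, hP⟩ := hψb
  obtain ⟨m, hm, hmφ⟩ := hinf
  have hD : ∀ x, |ψ'' x| ≤ lam * P + mu * C := fun x => by
    have h1 : ψ'' x = lam * ψ x - mu * φ x := by linarith [heq2 x]
    rw [h1]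
    have a1 := abs_le.1 (hP x)
    have a2 := abs_le.1 (hC x)
    rw [abs_le]; constructor <;> nlinarith
  have hK := aux_dbound ψ ψ' ψ'' hψd hψd2 P _ hP hD
  set K := 2 * P + (lam * P + mu * C) with hKdef
  have bA : BddAbove (Set.range φ) := ⟨C, by rintro _ ⟨x, rfl⟩; exact (abs_le.1 (hC x)).2⟩
  have bB : BddBelow (Set.range φ) := ⟨m, by rintro _ ⟨x, rfl⟩; exact hmφ x⟩
  have hS : ∀ x, φ x ≤ ⨆ x, φ x := fun x => le_ciSup bA x
  have hs : ∀ x, ⨅ x, φ x ≤ φ x := fun x => ciInf_le bB x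
  have hS' : ∀ B, (∀ x, φ x ≤ B) → ⨆ x, φ x ≤ B := fun B h => ciSup_le h
  have hs' : ∀ B, (∀ x, B ≤ φ x) → B ≤ ⨅ x, φ x := fun B h => le_ciInf h
  generalize (⨆ x, φ x) = S at hS hS'
  generalize (⨅ x, φ x) = s at hs hs'
  have nψd : ∀ x, HasDerivAt (fun x => -ψ x) (-ψ' x) x := fun x => (hψd x).neg
  have nψd2 : ∀ x, HasDerivAt (fun x => -ψ' x) (-ψ'' x) x := fun x => (hψd2 x).neg
  have nφd : ∀ x, HasDerivAt (fun x => -φ x) (-φ' x) x := fun x => (hφd x).neg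
  have nφd2 : ∀ x, HasDerivAt (fun x => -φ' x) (-φ'' x) x := fun x => (hφd2 x).neg
  have ψup : ∀ y, lam * ψ y ≤ mu * S := fun y => by
    suffices lam * ψ y - mu * S ≤ 0 by linarith
    apply aux_limit _ (lam + 1)
    intro ε hε
    obtain ⟨x, h1, -, h3⟩ := aux_maxp ψ ψ' ψ'' hψd hψd2 P hP y ε hε
    have := mul_le_mul_of_nonneg_left h1 hlam.le
    have := mul_le_mul_of_nonneg_left (hS x) hmu.le
    linarith [heq2 x]
  have ψlo : ∀ y, mu * s ≤ lam * ψ y := fun y => by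
    suffices mu * s - lam * ψ y ≤ 0 by linarith
    apply aux_limit _ (lam + 1)
    intro ε hε
    obtain ⟨x, h1, -, h3⟩ := aux_maxp _ _ _ nψd nψd2 P (by simpa using hP) y ε hε
    have := mul_le_mul_of_nonneg_left h1 hlam.le
    have := mul_le_mul_of_nonneg_left (hs x) hmu.le
    linarith [heq2 x]
  have hcm : 0 < χ * mu := mul_pos hχ hmu
  have hbc : 0 < b - χ * mu := by linarith
  have key : ∀ x, φ'' x - χ * (φ' x * ψ' x)
      + φ x * (a - χ * (lam * ψ x) - (b - χ * mu) * φ x) = 0 := fun x => by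
    have h1 : ψ'' x = lam * ψ x - mu * φ x := by linarith [heq2 x]
    have h2 := heq1 x
    rw [h1] at h2
    linarith
  have drift : ∀ x ε, |φ' x| ≤ ε → |χ * (φ' x * ψ' x)| ≤ χ * (ε * K) := fun x ε h => by
    rw [abs_mul, abs_mul, abs_of_pos hχ]
    have := (abs_nonneg _).trans h
    gcongr
    exact hK x
  have φup : ∀ y, (b - χ * mu) * φ y ≤ a - χ * mu * s := fun y => by
    suffices (b - χ * mu) * φ y - (a - χ * mu * s) ≤ 0 by linarith
    apply aux_limit _ ((1 + χ * K) / m + (b - χ * mu))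
    intro ε hε
    obtain ⟨x, h1, h2, h3⟩ := aux_maxp φ φ' φ'' hφd hφd2 C hC y ε hε
    have hd := (abs_le.1 (drift x ε h2)).1
    have hK0 : 0 ≤ K := (abs_nonneg _).trans (hK 0)
    have e1 := mul_le_mul_of_nonneg_left h1 hbc.le
    have e2 := mul_le_mul_of_nonneg_left (ψlo x) hχ.le
    have hq : (b - χ * mu) * φ x - (a - χ * (lam * ψ x)) ≤ ε * ((1 + χ * K) / m) := by
      by_contra hc
      push Not at hc
      have p0 : 0 ≤ ε * ((1 + χ * K) / m) := by positivity
      have p1 : m * (ε * ((1 + χ * K) / m)) = ε * (1 + χ * K) := by field_simp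
      have := mul_lt_mul_of_pos_left hc hm
      have := mul_le_mul_of_nonneg_right (hmφ x) (p0.trans hc.le)
      linarith [key x]
    linarith
  have φlo : ∀ y, a - χ * mu * S ≤ (b - χ * mu) * φ y := fun y => by
    suffices (a - χ * mu * S) - (b - χ * mu) * φ y ≤ 0 by linarith
    apply aux_limit _ ((1 + χ * K) / m + (b - χ * mu))
    intro ε hε
    obtain ⟨x, h1, h2, h3⟩ := aux_maxp _ _ _ nφd nφd2 C (by simpa using hC) y ε hε
    rw [abs_neg] at h2
    have hd := (abs_le.1 (drift x ε h2)).2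
    have hK0 : 0 ≤ K := (abs_nonneg _).trans (hK 0)
    have e1 := mul_le_mul_of_nonneg_left h1 hbc.le
    have e2 := mul_le_mul_of_nonneg_left (ψup x) hχ.le
    have hq : (a - χ * (lam * ψ x)) - (b - χ * mu) * φ x ≤ ε * ((1 + χ * K) / m) := by
      by_contra hc
      push Not at hc
      have p0 : 0 ≤ ε * ((1 + χ * K) / m) := by positivity
      have p1 : m * (ε * ((1 + χ * K) / m)) = ε * (1 + χ * K) := by field_simp
      have := mul_lt_mul_of_pos_left hc hm
      have := mul_le_mul_of_nonneg_right (hmφ x) (p0.trans hc.le)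
      linarith [key x]
    linarith
  have f1 : (b - χ * mu) * S ≤ a - χ * mu * s := by
    have := hS' ((a - χ * mu * s) / (b - χ * mu)) fun x => by
      rw [le_div_iff₀ hbc]; linarith [φup x]
    rw [le_div_iff₀ hbc] at this; linarith
  have f2 : a - χ * mu * S ≤ (b - χ * mu) * s := by
    have := hs' ((a - χ * mu * S) / (b - χ * mu)) fun x => by
      rw [div_le_iff₀ hbc]; linarith [φlo x]
    rw [div_le_iff₀ hbc] at this; linarith
  have hsS : S = s := by
    apply le_antisymm _ ((hs 0).trans (hS 0))
    by_contra hc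
    push Not at hc
    nlinarith [mul_pos (sub_pos.2 hb2) (sub_pos.2 hc)]
  subst hsS
  have hbS : b * S = a := by linarith
  have hSe : S = a / b := by rw [eq_div_iff hb.ne']; linarith
  refine ⟨fun x => ?_, fun x => ?_⟩
  · rw [← hSe]; exact le_antisymm (hS x) (hs x)
  · have h1 : lam * ψ x = mu * S := le_antisymm (ψup x) (ψlo x)
    rw [eq_div_iff (by positivity), ← hbS]
    linear_combination b * h1
end

section
/- Let a > 0, ε ∈ (0, 2a), δ > 0, M > 0, β ≥ 0, and let ρ satisfy (a − ε/2)/(1+δ) < ρ < a − ε/2. Let B ≥ 2M/(ρ(1+δ) − (a − ε/2)) and let ξ2 ∈ ℝ, and let u0 be C² and positive on [ξ2, ∞) satisfying, for all x ≥ ξ2: |u0″(x)|/u0(x) + β|u0′(x)|/u0(x) ≤ (a − ε/2) − ρ, and (1+δ)[|u0″(x)|/u0(x) + δ(u0′(x)/u0(x))²] + β(1+δ)|u0′(x)|/u0(x) ≤ (ρ(1+δ) − (a − ε/2))/2. Define w(x,t) = u0(x)e^{ρt} − B u0(x)^{1+δ} e^{ρ(1+δ)t}. Then at every point (x,t) with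 x ≥ ξ2, t ≥ 0 and w(x,t) > 0, the subsolution inequality w_t − w_xx + β|w_x| − (a − ε/2)w + M w^{1+δ} ≤ 0 holds. -/
/-- Key computation in the proof of Lemma 3.2: under conditions (1.24) and (1.25) on
`u0`, the function `w(x,t) = u0(x) e^{ρ t} - B u0(x)^{1+δ} e^{ρ(1+δ) t}` satisfies
the subsolution inequality `w_t - w_xx + β |w_x| - (a - ε/2) w + M w^{1+δ} ≤ 0` at
every point `(x, t)` with `x ≥ ξ2`, `t ≥ 0` and `w(x,t) > 0`.  The partial
derivatives are written out explicitly (here `^` is the real power `rpow`). -/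
theorem stmt12 (a ε δ M β ρ B ξ2 : ℝ) (u0 u0' u0'' : ℝ → ℝ)
    (ha : 0 < a) (hε : 0 < ε) (hε2 : ε < 2 * a) (hδ : 0 < δ) (hM : 0 < M)
    (hβ : 0 ≤ β)
    (hρ1 : (a - ε / 2) / (1 + δ) < ρ) (hρ2 : ρ < a - ε / 2)
    (hB : 2 * M / (ρ * (1 + δ) - (a - ε / 2)) ≤ B)
    (hd1 : ∀ x, ξ2 ≤ x → HasDerivAt u0 (u0' x) x)
    (hd2 : ∀ x, ξ2 ≤ x → HasDerivAt u0' (u0'' x) x)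
    (hcont : ContinuousOn u0'' (Set.Ici ξ2))
    (hpos : ∀ x, ξ2 ≤ x → 0 < u0 x)
    (h124 : ∀ x, ξ2 ≤ x →
      |u0'' x| / u0 x + β * |u0' x| / u0 x ≤ (a - ε / 2) - ρ)
    (h125 : ∀ x, ξ2 ≤ x →
      (1 + δ) * (|u0'' x| / u0 x + δ * (u0' x / u0 x) ^ 2)
        + β * (1 + δ) * (|u0' x| / u0 x) ≤ (ρ * (1 + δ) - (a - ε / 2)) / 2) :
    ∀ x t : ℝ, ξ2 ≤ x → 0 ≤ t →
      0 < u0 x * Real.exp (ρ * t) - B * u0 x ^ (1 + δ) * Real.exp (ρ * (1 + δ) * t) →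
      (ρ * u0 x * Real.exp (ρ * t)
          - B * (ρ * (1 + δ)) * u0 x ^ (1 + δ) * Real.exp (ρ * (1 + δ) * t))
        - (u0'' x * Real.exp (ρ * t)
          - B * (1 + δ) * (u0 x ^ δ * u0'' x + δ * u0 x ^ (δ - 1) * (u0' x) ^ 2)
              * Real.exp (ρ * (1 + δ) * t))
        + β * |u0' x * Real.exp (ρ * t)
          - B * (1 + δ) * u0 x ^ δ * u0' x * Real.exp (ρ * (1 + δ) * t)|
        - (a - ε / 2) * (u0 x * Real.exp (ρ * t)
          - B * u0 x ^ (1 + δ) * Real.exp (ρ * (1 + δ) * t))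
        + M * (u0 x * Real.exp (ρ * t)
          - B * u0 x ^ (1 + δ) * Real.exp (ρ * (1 + δ) * t)) ^ (1 + δ) ≤ 0 := by
  intro x t hx _ hw
  have hu := hpos x hx
  have h1 := h124 x hx
  have h2 := h125 x hx
  have hD : 0 < ρ * (1 + δ) - (a - ε / 2) := by
    rw [div_lt_iff₀ (by linarith)] at hρ1
    linarith
  have hBD : 2 * M ≤ B * (ρ * (1 + δ) - (a - ε / 2)) := by
    rwa [div_le_iff₀ hD] at hB
  have hB0 : 0 < B := lt_of_lt_of_le (by positivity) hB
  clear hd1 hd2 hcont hpos h124 h125 hB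
  obtain ⟨r, hr⟩ : ∃ r, u0'' x = r * u0 x := ⟨u0'' x / u0 x, by field_simp⟩
  obtain ⟨s, hs⟩ : ∃ s, u0' x = s * u0 x := ⟨u0' x / u0 x, by field_simp⟩
  rw [hr, hs] at h1 h2 ⊢
  generalize u0 x = u at *
  have e1 : |r * u| / u = |r| := by
    rw [abs_mul, abs_of_pos hu]; field_simp
  have e2 : |s * u| / u = |s| := by
    rw [abs_mul, abs_of_pos hu]; field_simp
  have e3 : s * u / u = s := by field_simp
  rw [mul_div_assoc, e1, e2] at h1
  rw [e1, e2, e3] at h2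
  have hE : Real.exp (ρ * (1 + δ) * t) = Real.exp (ρ * t) ^ (1 + δ) := by
    rw [← Real.exp_mul]; congr 1; ring
  have hud : u ^ (1 + δ) = u ^ δ * u := by
    rw [add_comm, Real.rpow_add hu, Real.rpow_one]
  have hud1 : u ^ (δ - 1) * u = u ^ δ := by
    rw [Real.rpow_sub hu, Real.rpow_one]; field_simp
  have hEp := Real.exp_pos (ρ * t)
  have hFp := Real.exp_pos (ρ * (1 + δ) * t)
  have hP : u ^ (1 + δ) * Real.exp (ρ * (1 + δ) * t) = (u * Real.exp (ρ * t)) ^ (1 + δ) := by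
    rw [hE, Real.mul_rpow hu.le hEp.le]
  have hPp : 0 < u ^ (1 + δ) * Real.exp (ρ * (1 + δ) * t) := by positivity
  have hW : (u * Real.exp (ρ * t) - B * u ^ (1 + δ) * Real.exp (ρ * (1 + δ) * t)) ^ (1 + δ)
      ≤ u ^ (1 + δ) * Real.exp (ρ * (1 + δ) * t) := by
    rw [hP]
    apply Real.rpow_le_rpow hw.le _ (by linarith)
    have := mul_pos hB0 hPp
    linarith
  generalize (u * Real.exp (ρ * t) - B * u ^ (1 + δ) * Real.exp (ρ * (1 + δ) * t)) ^ (1 + δ) = W at *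
  clear hP hE
  generalize Real.exp (ρ * (1 + δ) * t) = F at *
  generalize Real.exp (ρ * t) = E at *
  have k1 : u ^ δ * (r * u) + δ * u ^ (δ - 1) * (s * u) ^ 2
      = u ^ (1 + δ) * (r + δ * s ^ 2) := by
    rw [hud, ← hud1]; ring
  have k2 : s * u * E - B * (1 + δ) * u ^ δ * (s * u) * F
      = s * (u * E) - s * (B * (1 + δ) * (u ^ (1 + δ) * F)) := by
    rw [hud]; ring
  rw [k1, k2]
  have hv : 0 < u * E := by positivity
  have k3 : |s * (u * E) - s * (B * (1 + δ) * (u ^ (1 + δ) * F))|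
      ≤ |s| * (u * E) + |s| * (B * (1 + δ) * (u ^ (1 + δ) * F)) := by
    refine (abs_sub _ _).trans (le_of_eq ?_)
    rw [abs_mul, abs_mul s, abs_of_pos hv,
      abs_of_pos (show 0 < B * (1 + δ) * (u ^ (1 + δ) * F) by positivity)]
  have k4 := mul_le_mul_of_nonneg_left k3 hβ
  have k5 := mul_le_mul_of_nonneg_left hW hM.le
  generalize |s * (u * E) - s * (B * (1 + δ) * (u ^ (1 + δ) * F))| = A at *
  have m1 := mul_le_mul_of_nonneg_right h1 hv.le
  have m2 := mul_le_mul_of_nonneg_right h2 (mul_pos hB0 hPp).le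
  have m3 := mul_le_mul_of_nonneg_right (neg_abs_le r) hv.le
  have m4 := mul_le_mul_of_nonneg_right (le_abs_self r)
    (show 0 ≤ (1 + δ) * (B * (u ^ (1 + δ) * F)) by positivity)
  have m5 := mul_le_mul_of_nonneg_right hBD hPp.le
  generalize u ^ (1 + δ) = U at *
  linarith
end
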